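/- BAVaR versus AVaR: let α ∈ (0,1), let π be an α-coherent policy with common fixed-point values (V₁^π(x), V₂^π(x)), and let μ_π be the unique fixed point of the distributional Bellman operator T^π. Then for every state x ∈ X and every action a in the support of π(·|x), AVaR^left_α(μ_π^{(x,a)}) ≤ V₁^π(x) and V₂^π(x) ≤ AVaR^right_{1−α}(μ_π^{(x,a)}). -/

import Mathlib

open MeasureTheory ProbabilityTheory Finset Set

noncomputable section

/-- Quantile (generalized inverse distribution) function of a measure on `ℝ`. -/
def quantileFn (ν : Measure ℝ) (τ : ℝ) : ℝ :=
  sInf {z : ℝ | τ ≤ cdf ν z}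

/-- Left average value-at-risk at level `α`. -/
def avarLeft (α : ℝ) (ν : Measure ℝ) : ℝ :=
  (1 / α) * ∫ τ in (0:ℝ)..α, quantileFn ν τ

/-- Right average value-at-risk at level `1 - α`. -/
def avarRight (α : ℝ) (ν : Measure ℝ) : ℝ :=
  (1 / (1 - α)) * ∫ τ in α..(1:ℝ), quantileFn ν τ

/-- A measure on `ℝ` with bounded support. -/
def HasBoundedSupport (ν : Measure ℝ) : Prop :=
  ∃ a b : ℝ, ν (Set.Icc a b)ᶜ = 0

/-- Finite Markov decision process with fixed state and action spaces. -/
structure MDP (X A : Type) [Fintype X] [Fintype A] where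
  P : X → A → X → ℝ
  r : X → A → X → ℝ
  γ : ℝ
  P_nonneg : ∀ x a x', 0 ≤ P x a x'
  P_sum_one : ∀ x a, ∑ x', P x a x' = 1
  γ_nonneg : 0 ≤ γ
  γ_lt_one : γ < 1

variable {X A : Type} [Fintype X] [Fintype A]

/-- A stationary Markovian policy. -/
def IsPolicy (π : X → A → ℝ) : Prop :=
  (∀ x a, 0 ≤ π x a) ∧ ∀ x, ∑ a, π x a = 1

/-- The discrete measure `(T^π D_{α,Q})^{(x,a)}`. -/
def diatomicMeasure (M : MDP X A) (α : ℝ) (π : X → A → ℝ)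
    (Q : X → A → ℝ × ℝ) (x : X) (a : A) : Measure ℝ :=
  ∑ x' : X, ∑ a' : A, ENNReal.ofReal (M.P x a x' * π x' a') •
    (ENNReal.ofReal α • Measure.dirac (M.r x a x' + M.γ * (Q x' a').1)
      + ENNReal.ofReal (1 - α) • Measure.dirac (M.r x a x' + M.γ * (Q x' a').2))

/-- The diatomic Bellman operator `T^π_α`. -/
def diatomicT (M : MDP X A) (α : ℝ) (π : X → A → ℝ)
    (Q : X → A → ℝ × ℝ) : X → A → ℝ × ℝ :=
  fun x a => (avarLeft α (diatomicMeasure M α π Q x a),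
              avarRight α (diatomicMeasure M α π Q x a))

/-- The distributional Bellman operator. -/
def DBO (M : MDP X A) (π : X → A → ℝ) (μ : X → A → Measure ℝ) :
    X → A → Measure ℝ :=
  fun x a => ∑ x' : X, ∑ a' : A, ENNReal.ofReal (M.P x a x' * π x' a') •
    (μ x' a').map (fun z => M.r x a x' + M.γ * z)

theorem quantileFn_le_iff (ν : Measure ℝ) {τ : ℝ} (h0 : 0 < τ) (h1 : τ < 1) (z : ℝ) :
    quantileFn ν τ ≤ z ↔ τ ≤ cdf ν z := by
  have hbdd : BddBelow {z : ℝ | τ ≤ cdf ν z} := by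
    obtain ⟨b, hb⟩ := ((tendsto_cdf_atBot ν).eventually (gt_mem_nhds h0)).exists
    refine ⟨b, fun y hy => ?_⟩
    by_contra! hlt
    exact absurd (hy.trans (monotone_cdf ν hlt.le)) (not_le.2 hb)
  have hne : {z : ℝ | τ ≤ cdf ν z}.Nonempty := by
    obtain ⟨b, hb⟩ := ((tendsto_cdf_atTop ν).eventually (lt_mem_nhds h1)).exists
    exact ⟨b, hb.le⟩
  refine ⟨fun h => ?_, fun h => csInf_le hbdd h⟩
  have hright : Filter.Tendsto (cdf ν) (nhdsWithin z (Set.Ioi z)) (nhds (cdf ν z)) :=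
    ((cdf ν).right_continuous z).mono_left (nhdsWithin_mono _ Set.Ioi_subset_Ici_self)
  refine ge_of_tendsto hright ?_
  filter_upwards [self_mem_nhdsWithin] with y hy
  obtain ⟨w, hw, hwy⟩ := (csInf_lt_iff hbdd hne).1 (lt_of_le_of_lt h hy)
  exact le_trans hw (monotone_cdf ν hwy.le)

theorem monotoneOn_quantileFn (ν : Measure ℝ) :
    MonotoneOn (quantileFn ν) (Set.Ioo 0 1) := fun _ hs _ ht hst =>
  (quantileFn_le_iff ν hs.1 hs.2 _).2
    (hst.trans ((quantileFn_le_iff ν ht.1 ht.2 _).1 le_rfl))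

theorem aemeasurable_quantileFn (ν : Measure ℝ) :
    AEMeasurable (quantileFn ν) (volume.restrict (Set.Ioo 0 1)) :=
  aemeasurable_restrict_of_monotoneOn measurableSet_Ioo (monotoneOn_quantileFn ν)

theorem map_quantileFn (ν : Measure ℝ) [IsProbabilityMeasure ν] :
    (volume.restrict (Set.Ioo (0:ℝ) 1)).map (quantileFn ν) = ν := by
  have : IsFiniteMeasure ((volume.restrict (Set.Ioo (0:ℝ) 1)).map (quantileFn ν)) :=
    Measure.isFiniteMeasure_map _ _
  refine Measure.ext_of_Iic _ _ fun z => ?_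
  rw [Measure.map_apply_of_aemeasurable (aemeasurable_quantileFn ν) measurableSet_Iic,
    Measure.restrict_apply' measurableSet_Ioo]
  have hset : quantileFn ν ⁻¹' Set.Iic z ∩ Set.Ioo 0 1 = Set.Iic (cdf ν z) ∩ Set.Ioo 0 1 := by
    ext τ
    constructor
    · rintro ⟨h, hτ⟩
      exact ⟨(quantileFn_le_iff ν hτ.1 hτ.2 z).1 h, hτ⟩
    · rintro ⟨h, hτ⟩
      exact ⟨(quantileFn_le_iff ν hτ.1 hτ.2 z).2 h, hτ⟩
  have hae : (Set.Iic (cdf ν z) ∩ Set.Ioo 0 1 : Set ℝ) =ᵐ[volume] Set.Ioc 0 (cdf ν z) := by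
    have h : (Set.Iic (cdf ν z) ∩ Set.Ioc 0 1 : Set ℝ) = Set.Ioc 0 (cdf ν z) := by
      ext τ
      have := cdf_le_one ν z
      simp only [Set.mem_inter_iff, Set.mem_Iic, Set.mem_Ioc]
      constructor
      · rintro ⟨h1, h2, -⟩
        exact ⟨h2, h1⟩
      · rintro ⟨h1, h2⟩
        exact ⟨h2, h1, h2.trans this⟩
    rw [← h]
    exact (Filter.EventuallyEq.refl _ _).inter Ioo_ae_eq_Ioc
  rw [hset, measure_congr hae, Real.volume_Ioc, sub_zero, ofReal_cdf]

theorem integral_comp_quantileFn (ν : Measure ℝ) [IsProbabilityMeasure ν] {g : ℝ → ℝ}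
    (hg : Continuous g) : ∫ τ in (0:ℝ)..1, g (quantileFn ν τ) = ∫ z, g z ∂ν := by
  rw [intervalIntegral.integral_of_le zero_le_one, integral_Ioc_eq_integral_Ioo]
  conv_rhs => rw [← map_quantileFn ν]
  rw [integral_map (aemeasurable_quantileFn ν) hg.aestronglyMeasurable]

theorem intervalIntegrable_comp_quantileFn (ν : Measure ℝ) [IsProbabilityMeasure ν] {g : ℝ → ℝ}
    (hg : Integrable g ν) {s t : ℝ} (hs : s ∈ Set.Icc (0:ℝ) 1) (ht : t ∈ Set.Icc (0:ℝ) 1) :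
    IntervalIntegrable (fun τ => g (quantileFn ν τ)) volume s t := by
  have h01 : IntervalIntegrable (fun τ => g (quantileFn ν τ)) volume 0 1 := by
    rw [intervalIntegrable_iff_integrableOn_Ioo_of_le zero_le_one]
    rw [← map_quantileFn ν] at hg
    exact hg.comp_aemeasurable (aemeasurable_quantileFn ν)
  refine h01.mono_set ?_
  rw [Set.uIcc_of_le (zero_le_one' ℝ)]
  exact Set.uIcc_subset_Icc hs ht

section AVaR

variable {ν : Measure ℝ} {α : ℝ}

theorem mul_avarLeft (hα : α ∈ Set.Ioo (0:ℝ) 1) :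
    α * avarLeft α ν = ∫ τ in (0:ℝ)..α, quantileFn ν τ := by
  have := hα.1.ne'
  unfold avarLeft
  field_simp

theorem mul_avarRight (hα : α ∈ Set.Ioo (0:ℝ) 1) :
    (1 - α) * avarRight α ν = ∫ τ in α..(1:ℝ), quantileFn ν τ := by
  have : 1 - α ≠ 0 := (sub_pos.2 hα.2).ne'
  unfold avarRight
  field_simp

variable [IsProbabilityMeasure ν]

theorem avar_mean (hα : α ∈ Set.Ioo (0:ℝ) 1) (hν : Integrable (fun z => z) ν) :
    α * avarLeft α ν + (1 - α) * avarRight α ν = ∫ z, z ∂ν := by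
  rw [mul_avarLeft hα, mul_avarRight hα, intervalIntegral.integral_add_adjacent_intervals,
    integral_comp_quantileFn ν continuous_id']
  · exact intervalIntegrable_comp_quantileFn ν hν (by simp) ⟨hα.1.le, hα.2.le⟩
  · exact intervalIntegrable_comp_quantileFn ν hν ⟨hα.1.le, hα.2.le⟩ (by simp)

theorem avarLeft_le_quantileFn (hα : α ∈ Set.Ioo (0:ℝ) 1) (hν : Integrable (fun z => z) ν) :
    avarLeft α ν ≤ quantileFn ν α := by
  have h : ∫ τ in (0:ℝ)..α, quantileFn ν τ ≤ ∫ _ in (0:ℝ)..α, quantileFn ν α := by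
    refine intervalIntegral.integral_mono_on_of_le_Ioo hα.1.le
      (intervalIntegrable_comp_quantileFn ν hν (by simp) ⟨hα.1.le, hα.2.le⟩) (by simp)
      fun τ hτ => ?_
    exact monotoneOn_quantileFn ν ⟨hτ.1, hτ.2.trans hα.2⟩ hα hτ.2.le
  rw [← mul_avarLeft hα, intervalIntegral.integral_const, smul_eq_mul, sub_zero] at h
  exact le_of_mul_le_mul_left h hα.1

theorem quantileFn_le_avarRight (hα : α ∈ Set.Ioo (0:ℝ) 1) (hν : Integrable (fun z => z) ν) :
    quantileFn ν α ≤ avarRight α ν := by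
  have h : ∫ _ in α..(1:ℝ), quantileFn ν α ≤ ∫ τ in α..(1:ℝ), quantileFn ν τ := by
    refine intervalIntegral.integral_mono_on_of_le_Ioo hα.2.le (by simp)
      (intervalIntegrable_comp_quantileFn ν hν ⟨hα.1.le, hα.2.le⟩ (by simp))
      fun τ hτ => ?_
    exact monotoneOn_quantileFn ν hα ⟨hα.1.trans hτ.1, hτ.2⟩ hτ.1.le
  rw [← mul_avarRight hα, intervalIntegral.integral_const, smul_eq_mul] at h
  exact le_of_mul_le_mul_left h (sub_pos.2 hα.2)

theorem integrable_max_affine (hν : Integrable (fun z => z) ν) (c b : ℝ) :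
    Integrable (fun z => max (c - b * z) 0) ν :=
  ((integrable_const c).sub (hν.const_mul b)).pos_part

/-- The two-point law on the left and right average values-at-risk is below `ν` in the convex
order, tested on hinge functions. -/
theorem avar_hinge_le (hα : α ∈ Set.Ioo (0:ℝ) 1) (hν : Integrable (fun z => z) ν) (c b : ℝ) :
    α * max (c - b * avarLeft α ν) 0 + (1 - α) * max (c - b * avarRight α ν) 0
      ≤ ∫ z, max (c - b * z) 0 ∂ν := by
  have hm : α ∈ Set.Icc (0:ℝ) 1 := ⟨hα.1.le, hα.2.le⟩
  have segment : ∀ s t : ℝ, s ∈ Set.Icc (0:ℝ) 1 → t ∈ Set.Icc (0:ℝ) 1 → s ≤ t →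
      max ((t - s) * c - b * ∫ τ in s..t, quantileFn ν τ) 0
        ≤ ∫ τ in s..t, max (c - b * quantileFn ν τ) 0 := by
    intro s t hs ht hst
    have hq := intervalIntegrable_comp_quantileFn ν hν hs ht
    have hh := intervalIntegrable_comp_quantileFn ν (integrable_max_affine hν c b) hs ht
    refine max_le ?_ (intervalIntegral.integral_nonneg hst fun τ _ => le_max_right _ _)
    have h : ∫ τ in s..t, (c - b * quantileFn ν τ)
        = (t - s) * c - b * ∫ τ in s..t, quantileFn ν τ := by
      rw [intervalIntegral.integral_sub (by simp) (hq.const_mul b),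
        intervalIntegral.integral_const, intervalIntegral.integral_const_mul, smul_eq_mul]
    rw [← h]
    refine intervalIntegral.integral_mono_on hst ?_ hh fun τ _ => le_max_left _ _
    exact IntervalIntegrable.sub (by simp) (hq.const_mul b)
  have hL := segment 0 α (by simp) hm hα.1.le
  have hR := segment α 1 hm (by simp) hα.2.le
  rw [← mul_avarLeft hα] at hL
  rw [← mul_avarRight hα] at hR
  rw [← integral_comp_quantileFn ν (g := fun z => max (c - b * z) 0) (by fun_prop),
    ← intervalIntegral.integral_add_adjacent_intervals
      (intervalIntegrable_comp_quantileFn ν (integrable_max_affine hν c b) (by simp) hm)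
      (intervalIntegrable_comp_quantileFn ν (integrable_max_affine hν c b) hm (by simp))]
  rw [mul_max_of_nonneg _ _ hα.1.le, mul_max_of_nonneg _ _ (sub_pos.2 hα.2).le]
  refine add_le_add (le_trans (le_of_eq ?_) hL) (le_trans (le_of_eq ?_) hR) <;>
  · congr 1 <;> ring

theorem le_avarLeft (hα : α ∈ Set.Ioo (0:ℝ) 1) (hν : Integrable (fun z => z) ν) (c : ℝ) :
    α * c - ∫ z, max (c - z) 0 ∂ν ≤ α * avarLeft α ν := by
  have h := avar_hinge_le hα hν c 1
  simp only [one_mul] at h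
  have h1 : α * (c - avarLeft α ν) ≤ α * max (c - avarLeft α ν) 0 :=
    mul_le_mul_of_nonneg_left (le_max_left _ _) hα.1.le
  have h2 : 0 ≤ (1 - α) * max (c - avarRight α ν) 0 :=
    mul_nonneg (sub_pos.2 hα.2).le (le_max_right _ _)
  linarith

theorem avarLeft_eq_quantileFn (hα : α ∈ Set.Ioo (0:ℝ) 1) (hν : Integrable (fun z => z) ν) :
    α * avarLeft α ν
      = α * quantileFn ν α - ∫ z, max (quantileFn ν α - z) 0 ∂ν := by
  set c := quantileFn ν α with hc
  have hm : α ∈ Set.Icc (0:ℝ) 1 := ⟨hα.1.le, hα.2.le⟩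
  have hint : Integrable (fun z => max (c - z) 0) ν := by
    simpa using integrable_max_affine hν c 1
  rw [← integral_comp_quantileFn ν (g := fun z => max (c - z) 0) (by fun_prop),
    ← intervalIntegral.integral_add_adjacent_intervals
      (intervalIntegrable_comp_quantileFn ν hint (by simp) hm)
      (intervalIntegrable_comp_quantileFn ν hint hm (by simp))]
  have h1 : ∫ τ in (0:ℝ)..α, max (c - quantileFn ν τ) 0
      = ∫ τ in (0:ℝ)..α, (c - quantileFn ν τ) := by
    rw [intervalIntegral.integral_of_le hα.1.le, intervalIntegral.integral_of_le hα.1.le]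
    refine setIntegral_congr_fun measurableSet_Ioc fun τ hτ => max_eq_left (sub_nonneg.2 ?_)
    exact monotoneOn_quantileFn ν ⟨hτ.1, hτ.2.trans_lt hα.2⟩ hα hτ.2
  have h2 : ∫ τ in α..(1:ℝ), max (c - quantileFn ν τ) 0 = 0 := by
    rw [intervalIntegral.integral_of_le hα.2.le, integral_Ioc_eq_integral_Ioo]
    refine setIntegral_eq_zero_of_forall_eq_zero fun τ hτ => max_eq_right (sub_nonpos.2 ?_)
    exact monotoneOn_quantileFn ν hα ⟨hα.1.trans hτ.1, hτ.2⟩ hτ.1.le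
  rw [h1, h2, intervalIntegral.integral_sub (by simp)
    (intervalIntegrable_comp_quantileFn ν hν (by simp) hm), intervalIntegral.integral_const,
    mul_avarLeft hα]
  simp

end AVaR

/-- Moving the atoms of a two-point law apart while keeping the mean increases hinge integrals;
moving the lower atom up by at most `ε` decreases them by at most `α * b * ε`. -/
theorem diatomic_hinge_le {α c b ε l r l' r' : ℝ} (hα : α ∈ Set.Ioo (0:ℝ) 1) (hb : 0 ≤ b)
    (hε : 0 ≤ ε) (hlr : l ≤ r) (hl' : l' ≤ l + ε)
    (hmean : α * l' + (1 - α) * r' = α * l + (1 - α) * r) :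
    α * max (c - b * l) 0 + (1 - α) * max (c - b * r) 0
      ≤ α * max (c - b * l') 0 + (1 - α) * max (c - b * r') 0 + α * (b * ε) := by
  obtain ⟨hα0, hα1⟩ := hα
  have hα2 : 0 < 1 - α := sub_pos.2 hα1
  rcases le_total l' l with h | h
  · have hr : r ≤ r' := by
      refine le_of_mul_le_mul_left ?_ hα2
      nlinarith [mul_le_mul_of_nonneg_left h hα0.le]
    have e0 : 0 ≤ α * (b * ε) := by positivity
    have h1 := mul_le_mul_of_nonneg_left (le_max_left (c - b * l') 0) hα0.le
    have h2 := mul_le_mul_of_nonneg_left (le_max_left (c - b * r') 0) hα2.le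
    have h3 := mul_nonneg hα0.le (le_max_right (c - b * l') 0)
    have h4 := mul_nonneg hα2.le (le_max_right (c - b * r') 0)
    have h5 := mul_le_mul_of_nonneg_left (mul_le_mul_of_nonneg_left h hb) hα0.le
    have h6 := mul_le_mul_of_nonneg_left hlr hb
    have hbm : b * (α * l' + (1 - α) * r') = b * (α * l + (1 - α) * r) := by rw [hmean]
    rcases le_total (c - b * l) 0 with hl | hl <;> rcases le_total (c - b * r) 0 with hr | hr
    all_goals simp only [max_eq_left, max_eq_right, hl, hr]
    all_goals nlinarith
  · have hr : r' ≤ r := by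
      refine le_of_mul_le_mul_left ?_ hα2
      nlinarith [mul_le_mul_of_nonneg_left h hα0.le]
    have h1 : max (c - b * r) 0 ≤ max (c - b * r') 0 :=
      max_le_max_right _ (by nlinarith [mul_le_mul_of_nonneg_left hr hb])
    have h2 : max (c - b * l) 0 ≤ max (c - b * l') 0 + b * ε := by
      have := mul_le_mul_of_nonneg_left hl' hb
      have := mul_nonneg hb hε
      refine max_le ?_ (by positivity)
      nlinarith [le_max_left (c - b * l') 0]
    nlinarith [mul_le_mul_of_nonneg_left h1 hα2.le, mul_le_mul_of_nonneg_left h2 hα0.le]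

theorem nonpos_of_contracting {ι : Type*} [Finite ι] {f : ι → ℝ} {γ : ℝ} (hγ : γ < 1)
    (h : ∀ ε, 0 ≤ ε → (∀ i, f i ≤ ε) → ∀ i, f i ≤ γ * ε) (i : ι) : f i ≤ 0 := by
  have : Nonempty ι := ⟨i⟩
  obtain ⟨j, hj⟩ := Finite.exists_max f
  by_contra! hi
  have hpos : 0 < f j := hi.trans_le (hj i)
  nlinarith [h (f j) hpos.le hj j]

theorem HasBoundedSupport.integrable_id {ν : Measure ℝ} [IsProbabilityMeasure ν]
    (h : HasBoundedSupport ν) : Integrable (fun z => z) ν := by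
  obtain ⟨a, b, hab⟩ := h
  refine Integrable.of_mem_Icc a b aemeasurable_id' ?_
  exact hab

/-- The weight of the successor pair `(x', a')`. -/
def transitionWeight (M : MDP X A) (π : X → A → ℝ) (x : X) (a : A) (p : X × A) : ℝ :=
  M.P x a p.1 * π p.1 p.2

section Operators

variable {M : MDP X A} {π : X → A → ℝ} {α : ℝ}

theorem transitionWeight_nonneg (hπ : IsPolicy π) (x : X) (a : A) (p : X × A) :
    0 ≤ transitionWeight M π x a p :=
  mul_nonneg (M.P_nonneg _ _ _) (hπ.1 _ _)

theorem sum_transitionWeight (hπ : IsPolicy π) (x : X) (a : A) :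
    ∑ p, transitionWeight M π x a p = 1 := by
  simp only [transitionWeight, Fintype.sum_prod_type, ← Finset.mul_sum, hπ.2, mul_one, M.P_sum_one]

theorem sum_transitionWeight_mul_le (hπ : IsPolicy π) (x : X) (a : A) {f g : X × A → ℝ} {δ : ℝ}
    (h : ∀ p, f p ≤ g p + δ) :
    ∑ p, transitionWeight M π x a p * f p ≤ ∑ p, transitionWeight M π x a p * g p + δ := by
  calc ∑ p, transitionWeight M π x a p * f p
      ≤ ∑ p, transitionWeight M π x a p * (g p + δ) := Finset.sum_le_sum fun p _ =>
        mul_le_mul_of_nonneg_left (h p) (transitionWeight_nonneg hπ x a p)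
    _ = _ := by
      simp only [mul_add, Finset.sum_add_distrib, ← Finset.sum_mul, sum_transitionWeight hπ,
        one_mul]

theorem diatomicMeasure_eq (Q : X → A → ℝ × ℝ) (x : X) (a : A) :
    diatomicMeasure M α π Q x a = ∑ p : X × A, ENNReal.ofReal (transitionWeight M π x a p) •
      (ENNReal.ofReal α • Measure.dirac (M.r x a p.1 + M.γ * (Q p.1 p.2).1)
      + ENNReal.ofReal (1 - α) • Measure.dirac (M.r x a p.1 + M.γ * (Q p.1 p.2).2)) := by
  rw [Fintype.sum_prod_type]
  rfl

theorem DBO_eq (μ : X → A → Measure ℝ) (x : X) (a : A) :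
    DBO M π μ x a = ∑ p : X × A, ENNReal.ofReal (transitionWeight M π x a p) •
      (μ p.1 p.2).map (fun z => M.r x a p.1 + M.γ * z) := by
  rw [Fintype.sum_prod_type]
  rfl

theorem integral_mixture {ι : Type*} [Fintype ι] {w : ι → ℝ} (hw : ∀ i, 0 ≤ w i)
    {κ : ι → Measure ℝ} {g : ℝ → ℝ} (hg : ∀ i, Integrable g (κ i)) :
    ∫ z, g z ∂(∑ i, ENNReal.ofReal (w i) • κ i) = ∑ i, w i * ∫ z, g z ∂(κ i) := by
  rw [integral_finsetSum_measure fun i _ => (hg i).smul_measure ENNReal.ofReal_ne_top]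
  simp only [integral_smul_measure, ENNReal.toReal_ofReal (hw _), smul_eq_mul]

theorem integrable_diatomic (g : ℝ → ℝ) (s t : ℝ) :
    Integrable g (ENNReal.ofReal α • Measure.dirac s + ENNReal.ofReal (1 - α) • Measure.dirac t) :=
  ((integrable_dirac (by simp)).smul_measure ENNReal.ofReal_ne_top).add_measure
    ((integrable_dirac (by simp)).smul_measure ENNReal.ofReal_ne_top)

theorem isProbabilityMeasure_diatomicMeasure (hα : α ∈ Set.Ioo (0:ℝ) 1) (hπ : IsPolicy π)
    (Q : X → A → ℝ × ℝ) (x : X) (a : A) :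
    IsProbabilityMeasure (diatomicMeasure M α π Q x a) := by
  refine ⟨?_⟩
  rw [diatomicMeasure_eq]
  simp only [Measure.coe_finsetSum, Finset.sum_apply, Measure.smul_apply, Measure.add_apply,
    measure_univ, smul_eq_mul, mul_one]
  rw [← ENNReal.ofReal_add hα.1.le (sub_pos.2 hα.2).le]
  simp only [add_sub_cancel, ENNReal.ofReal_one, mul_one]
  rw [← ENNReal.ofReal_sum_of_nonneg fun p _ => transitionWeight_nonneg hπ x a p,
    sum_transitionWeight hπ, ENNReal.ofReal_one]

theorem integrable_diatomicMeasure (Q : X → A → ℝ × ℝ) (x : X) (a : A) (g : ℝ → ℝ) :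
    Integrable g (diatomicMeasure M α π Q x a) := by
  rw [diatomicMeasure_eq]
  exact integrable_finsetSum_measure.2 fun p _ =>
    (integrable_diatomic g _ _).smul_measure ENNReal.ofReal_ne_top

theorem integral_diatomicMeasure (hα : α ∈ Set.Ioo (0:ℝ) 1) (hπ : IsPolicy π)
    (Q : X → A → ℝ × ℝ) (x : X) (a : A) (g : ℝ → ℝ) :
    ∫ z, g z ∂(diatomicMeasure M α π Q x a) = ∑ p, transitionWeight M π x a p *
      (α * g (M.r x a p.1 + M.γ * (Q p.1 p.2).1)
        + (1 - α) * g (M.r x a p.1 + M.γ * (Q p.1 p.2).2)) := by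
  rw [diatomicMeasure_eq, integral_mixture (transitionWeight_nonneg hπ x a)
    fun p => integrable_diatomic g _ _]
  refine Finset.sum_congr rfl fun p _ => ?_
  rw [integral_add_measure ((integrable_dirac (by simp)).smul_measure ENNReal.ofReal_ne_top)
    ((integrable_dirac (by simp)).smul_measure ENNReal.ofReal_ne_top)]
  simp only [integral_smul_measure, integral_dirac, ENNReal.toReal_ofReal hα.1.le,
    ENNReal.toReal_ofReal (sub_pos.2 hα.2).le, smul_eq_mul]

theorem integral_DBO (hπ : IsPolicy π) {μ : X → A → Measure ℝ} (x : X) (a : A) {g : ℝ → ℝ}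
    (hg : Continuous g)
    (hint : ∀ p : X × A, Integrable (fun z => g (M.r x a p.1 + M.γ * z)) (μ p.1 p.2)) :
    ∫ z, g z ∂(DBO M π μ x a) = ∑ p : X × A, transitionWeight M π x a p *
      ∫ z, g (M.r x a p.1 + M.γ * z) ∂(μ p.1 p.2) := by
  have hf : ∀ p : X × A, AEMeasurable (fun z : ℝ => M.r x a p.1 + M.γ * z) (μ p.1 p.2) :=
    fun p => by fun_prop
  rw [DBO_eq, integral_mixture (transitionWeight_nonneg hπ x a)
    fun p => (integrable_map_measure hg.aestronglyMeasurable (hf p)).2 (hint p)]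
  refine Finset.sum_congr rfl fun p _ => ?_
  rw [integral_map (hf p) hg.aestronglyMeasurable]

/-- Solutions of the linear Bellman equation for the means coincide. -/
theorem bellman_mean_unique (hπ : IsPolicy π) {m m' : X × A → ℝ}
    (hm : ∀ q, m q = ∑ p, transitionWeight M π q.1 q.2 p * (M.r q.1 q.2 p.1 + M.γ * m p))
    (hm' : ∀ q, m' q = ∑ p, transitionWeight M π q.1 q.2 p * (M.r q.1 q.2 p.1 + M.γ * m' p))
    (q : X × A) : m q ≤ m' q := by
  refine sub_nonpos.1 (nonpos_of_contracting (f := fun q => m q - m' q) M.γ_lt_one ?_ q)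
  intro ε _ h q
  rw [sub_le_iff_le_add', hm q, hm' q]
  refine sum_transitionWeight_mul_le hπ q.1 q.2 fun p => ?_
  nlinarith [mul_le_mul_of_nonneg_left (h p) M.γ_nonneg]

theorem avar_comparison (hα : α ∈ Set.Ioo (0:ℝ) 1) (hπ : IsPolicy π)
    {Q : X → A → ℝ × ℝ} (hfix : diatomicT M α π Q = Q) {μ : X → A → Measure ℝ}
    (hprob : ∀ x a, IsProbabilityMeasure (μ x a))
    (hint : ∀ x a, Integrable (fun z => z) (μ x a)) (hμ : DBO M π μ = μ) (x : X) (a : A) :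
    avarLeft α (μ x a) ≤ (Q x a).1 ∧ (Q x a).2 ≤ avarRight α (μ x a) := by
  have hη := fun x a => isProbabilityMeasure_diatomicMeasure (M := M) hα hπ Q x a
  have hηint := fun x a => integrable_diatomicMeasure (M := M) (α := α) (π := π) Q x a fun z => z
  have hQ1 : ∀ x a, (Q x a).1 = avarLeft α (diatomicMeasure M α π Q x a) := fun x a =>
    congrArg Prod.fst (congrFun (congrFun hfix x) a).symm
  have hQ2 : ∀ x a, (Q x a).2 = avarRight α (diatomicMeasure M α π Q x a) := fun x a =>
    congrArg Prod.snd (congrFun (congrFun hfix x) a).symm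
  have hQle : ∀ x a, (Q x a).1 ≤ (Q x a).2 := fun x a => by
    rw [hQ1, hQ2]
    exact (avarLeft_le_quantileFn hα (hηint x a)).trans (quantileFn_le_avarRight hα (hηint x a))
  have hmeanμ : ∀ q : X × A, ∫ z, z ∂(μ q.1 q.2) = ∑ p : X × A,
      transitionWeight M π q.1 q.2 p * (M.r q.1 q.2 p.1 + M.γ * ∫ z, z ∂(μ p.1 p.2)) := by
    intro q
    conv_lhs => rw [← hμ]
    rw [integral_DBO hπ q.1 q.2 continuous_id'
      fun p => (integrable_const _).add ((hint _ _).const_mul _)]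
    refine Finset.sum_congr rfl fun p _ => ?_
    rw [integral_add (integrable_const _) ((hint _ _).const_mul _), integral_const_mul]
    simp
  have hmeanQ : ∀ q : X × A, α * (Q q.1 q.2).1 + (1 - α) * (Q q.1 q.2).2 = ∑ p : X × A,
      transitionWeight M π q.1 q.2 p *
        (M.r q.1 q.2 p.1 + M.γ * (α * (Q p.1 p.2).1 + (1 - α) * (Q p.1 p.2).2)) := by
    intro q
    conv_lhs => rw [hQ1, hQ2]
    rw [avar_mean hα (hηint _ _), integral_diatomicMeasure hα hπ Q q.1 q.2 fun z => z]
    exact Finset.sum_congr rfl fun p _ => by ring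
  have hmean : ∀ x a, α * avarLeft α (μ x a) + (1 - α) * avarRight α (μ x a)
      = α * (Q x a).1 + (1 - α) * (Q x a).2 := fun x a => by
    rw [avar_mean hα (hint x a)]
    exact le_antisymm (bellman_mean_unique hπ hmeanμ hmeanQ (x, a))
      (bellman_mean_unique hπ hmeanQ hmeanμ (x, a))
  have hleft : avarLeft α (μ x a) ≤ (Q x a).1 := by
    refine sub_nonpos.1 (nonpos_of_contracting
      (f := fun q : X × A => avarLeft α (μ q.1 q.2) - (Q q.1 q.2).1) M.γ_lt_one ?_ (x, a))
    rintro ε hε h ⟨x, a⟩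
    change avarLeft α (μ x a) - (Q x a).1 ≤ M.γ * ε
    have h1 := avarLeft_eq_quantileFn hα (hint x a)
    set c := quantileFn (μ x a) α
    have h2 := le_avarLeft hα (hηint x a) c
    rw [← hQ1, integral_diatomicMeasure hα hπ Q x a fun z => max (c - z) 0] at h2
    have hcomp : ∀ y z : ℝ, c - (y + M.γ * z) = c - y - M.γ * z := fun y z => by ring
    have hν : ∫ z, max (c - z) 0 ∂(μ x a) = ∑ p : X × A, transitionWeight M π x a p *
        ∫ z, max (c - M.r x a p.1 - M.γ * z) 0 ∂(μ p.1 p.2) := by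
      conv_lhs => rw [← hμ]
      rw [integral_DBO hπ x a (g := fun z => max (c - z) 0) (by fun_prop)]
      · simp only [hcomp]
      · intro p
        simp only [hcomp]
        exact integrable_max_affine (hint _ _) _ _
    rw [hν] at h1
    simp only [hcomp] at h2
    have h3 := sum_transitionWeight_mul_le (M := M) hπ x a (δ := α * (M.γ * ε))
      (f := fun p => α * max (c - M.r x a p.1 - M.γ * (Q p.1 p.2).1) 0
        + (1 - α) * max (c - M.r x a p.1 - M.γ * (Q p.1 p.2).2) 0)
      (g := fun p => ∫ z, max (c - M.r x a p.1 - M.γ * z) 0 ∂(μ p.1 p.2)) fun p =>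
        (diatomic_hinge_le hα M.γ_nonneg hε (hQle _ _)
          (sub_le_iff_le_add'.1 (h p)) (hmean _ _)).trans
          (add_le_add_left (avar_hinge_le hα (hint _ _) _ _) _)
    refine le_of_mul_le_mul_left ?_ hα.1
    linarith
  refine ⟨hleft, le_of_mul_le_mul_left ?_ (sub_pos.2 hα.2)⟩
  linarith [hmean x a, mul_le_mul_of_nonneg_left hleft hα.1.le]

end Operators

theorem stmt11 (M : MDP X A) (α : ℝ) (hα : α ∈ Set.Ioo (0:ℝ) 1)
    (π : X → A → ℝ) (hπ : IsPolicy π)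
    (Qpi : X → A → ℝ × ℝ) (hfix : diatomicT M α π Qpi = Qpi)
    (V1 V2 : X → ℝ)
    (hcoh : ∀ x a, 0 < π x a → Qpi x a = (V1 x, V2 x))
    (μ : X → A → Measure ℝ)
    (hprob : ∀ x a, IsProbabilityMeasure (μ x a))
    (hbdd : ∀ x a, HasBoundedSupport (μ x a))
    (hμ : DBO M π μ = μ) :
    ∀ x a, 0 < π x a →
      avarLeft α (μ x a) ≤ V1 x ∧ V2 x ≤ avarRight α (μ x a) := by
  intro x a hxa
  have h := avar_comparison hα hπ hfix hprob (fun x a => (hbdd x a).integrable_id) hμ x a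
  rwa [hcoh x a hxa] at h

end
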